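/- Let a, b, c be positive integers and let ψ ∈ ℂ^a ⊗ ℂ^b ⊗ ℂ^c be such that ρ_A(ψ), ρ_B(ψ), ρ_C(ψ) are all diagonal matrices with strictly decreasing diagonal entries. Then the complex-linear map (X,Y,Z) ↦ (X⊗I⊗I + I⊗Y⊗I + I⊗I⊗Z)ψ, defined on triples of strictly lower-triangular complex matrices X (size a×a), Y (size b×b), Z (size c×c), is injective. -/

import Mathlib

open scoped BigOperators

noncomputable section

/-- The reduced density matrix on the first subsystem. -/
def rhoA {a b c : ℕ} (ψ : Fin a × Fin b × Fin c → ℂ) : Matrix (Fin a) (Fin a) ℂ :=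
  Matrix.of fun i i' => ∑ j : Fin b, ∑ k : Fin c, ψ (i, j, k) * (starRingEnd ℂ) (ψ (i', j, k))

/-- The reduced density matrix on the second subsystem. -/
def rhoB {a b c : ℕ} (ψ : Fin a × Fin b × Fin c → ℂ) : Matrix (Fin b) (Fin b) ℂ :=
  Matrix.of fun j j' => ∑ i : Fin a, ∑ k : Fin c, ψ (i, j, k) * (starRingEnd ℂ) (ψ (i, j', k))

/-- The reduced density matrix on the third subsystem. -/
def rhoC {a b c : ℕ} (ψ : Fin a × Fin b × Fin c → ℂ) : Matrix (Fin c) (Fin c) ℂ :=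
  Matrix.of fun k k' => ∑ i : Fin a, ∑ j : Fin b, ψ (i, j, k) * (starRingEnd ℂ) (ψ (i, j, k'))

/-- `lam` is the vector of eigenvalues of `ρ`, listed in nonincreasing order
with multiplicity. -/
def IsSpecDown {n : ℕ} (ρ : Matrix (Fin n) (Fin n) ℂ) (lam : Fin n → ℝ) : Prop :=
  Antitone lam ∧ ∃ (hρ : ρ.IsHermitian) (σ : Equiv.Perm (Fin n)), lam = hρ.eigenvalues ∘ σ

/-- The Kronecker cone `C(a,b,c)`. -/
def KronCone (a b c : ℕ) : Set ((Fin a → ℝ) × (Fin b → ℝ) × (Fin c → ℝ)) :=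
  { lam | ∃ ψ : Fin a × Fin b × Fin c → ℂ,
      IsSpecDown (rhoA ψ) lam.1 ∧ IsSpecDown (rhoB ψ) lam.2.1 ∧ IsSpecDown (rhoC ψ) lam.2.2 }

/-- The pairing `⟨(H,z), λ⟩`. -/
def wtPair {a b c : ℕ} (HA : Fin a → ℝ) (HB : Fin b → ℝ) (HC : Fin c → ℝ) (z : ℝ)
    (lam : (Fin a → ℝ) × (Fin b → ℝ) × (Fin c → ℝ)) : ℝ :=
  (∑ i, HA i * lam.1 i) + (∑ j, HB j * lam.2.1 j) + (∑ k, HC k * lam.2.2 k)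
    + z * ∑ i, lam.1 i

/-- `H = (H_A, H_B, H_C)` is traceless. -/
def Traceless {a b c : ℕ} (HA : Fin a → ℝ) (HB : Fin b → ℝ) (HC : Fin c → ℝ) : Prop :=
  (∑ i, HA i) = 0 ∧ (∑ j, HB j) = 0 ∧ (∑ k, HC k) = 0

/-- `(H, z)` is a facet normal of the Kronecker cone `C(a,b,c)`. -/
def IsFacetNormal (a b c : ℕ) (HA : Fin a → ℝ) (HB : Fin b → ℝ) (HC : Fin c → ℝ)
    (z : ℝ) : Prop :=
  Traceless HA HB HC ∧ ¬(HA = 0 ∧ HB = 0 ∧ HC = 0 ∧ z = 0) ∧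
  (∀ lam ∈ KronCone a b c, 0 ≤ wtPair HA HB HC z lam) ∧
  Module.finrank ℝ
    (affineSpan ℝ {lam ∈ KronCone a b c | wtPair HA HB HC z lam = 0}).direction
    = a + b + c - 3

/-- `(H, z)` is a trivial (Weyl chamber) normal. -/
def IsTrivialNormal {a b c : ℕ} (HA : Fin a → ℝ) (HB : Fin b → ℝ) (HC : Fin c → ℝ)
    (z : ℝ) : Prop :=
  ∃ t : ℝ, 0 < t ∧
    ((∃ i i' : Fin a, i < i' ∧ HA = t • (Pi.single i 1 - Pi.single i' 1) ∧
        HB = 0 ∧ HC = 0 ∧ z = 0) ∨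
     (∃ j j' : Fin b, j < j' ∧ HB = t • (Pi.single j 1 - Pi.single j' 1) ∧
        HA = 0 ∧ HC = 0 ∧ z = 0) ∨
     (∃ k k' : Fin c, k < k' ∧ HC = t • (Pi.single k 1 - Pi.single k' 1) ∧
        HA = 0 ∧ HB = 0 ∧ z = 0))

/-- The subspace of vectors supported on coordinates satisfying `P`. -/
def suppSubmodule {ι : Type*} (P : ι → Prop) : Submodule ℂ (ι → ℂ) where
  carrier := {ψ | ∀ p, ¬ P p → ψ p = 0}
  add_mem' := by
    intro x y hx hy p hp
    simp only [Pi.add_apply, hx p hp, hy p hp, add_zero]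
  zero_mem' := by intro p _; rfl
  smul_mem' := by
    intro r x hx p hp
    simp only [Pi.smul_apply, hx p hp, smul_zero]

/-- The zero-weight space `ℋ₀(H,z)`. -/
def weight0Space {a b c : ℕ} (HA : Fin a → ℝ) (HB : Fin b → ℝ) (HC : Fin c → ℝ)
    (z : ℝ) : Submodule ℂ (Fin a × Fin b × Fin c → ℂ) :=
  suppSubmodule fun p => HA p.1 + HB p.2.1 + HC p.2.2 + z = 0

/-- The negative-weight space `ℋ₋(H,z)`. -/
def weightNegSpace {a b c : ℕ} (HA : Fin a → ℝ) (HB : Fin b → ℝ) (HC : Fin c → ℝ)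
    (z : ℝ) : Submodule ℂ (Fin a × Fin b × Fin c → ℂ) :=
  suppSubmodule fun p => HA p.1 + HB p.2.1 + HC p.2.2 + z < 0

/-- Strictly lower triangular matrices `X` with `X i' i = 0` unless
`i < i'` and `Hv i' < Hv i`. -/
def lowerMod {d : ℕ} (Hv : Fin d → ℝ) : Submodule ℂ (Matrix (Fin d) (Fin d) ℂ) where
  carrier := {X | ∀ i' i, ¬ (i < i' ∧ Hv i' < Hv i) → X i' i = 0}
  add_mem' := by
    intro X Y hX hY i' i h
    simp only [Matrix.add_apply, hX i' i h, hY i' i h, add_zero]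
  zero_mem' := by intro i' i h; rfl
  smul_mem' := by
    intro r X hX i' i h
    simp only [Matrix.smul_apply, hX i' i h, smul_zero]

/-- The nilpotent algebra `𝔫₋(H)`. -/
def nMinusMod {a b c : ℕ} (HA : Fin a → ℝ) (HB : Fin b → ℝ) (HC : Fin c → ℝ) :
    Submodule ℂ (Matrix (Fin a) (Fin a) ℂ × Matrix (Fin b) (Fin b) ℂ ×
      Matrix (Fin c) (Fin c) ℂ) :=
  (lowerMod HA).prod ((lowerMod HB).prod (lowerMod HC))

/-- The infinitesimal action `(X,Y,Z) ↦ (X⊗I⊗I + I⊗Y⊗I + I⊗I⊗Z)ψ`. -/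
def act {a b c : ℕ}
    (t : Matrix (Fin a) (Fin a) ℂ × Matrix (Fin b) (Fin b) ℂ × Matrix (Fin c) (Fin c) ℂ)
    (ψ : Fin a × Fin b × Fin c → ℂ) : Fin a × Fin b × Fin c → ℂ := fun p =>
  (∑ i', t.1 p.1 i' * ψ (i', p.2.1, p.2.2)) +
  (∑ j', t.2.1 p.2.1 j' * ψ (p.1, j', p.2.2)) +
  (∑ k', t.2.2 p.2.2 k' * ψ (p.1, p.2.1, k'))

/-- The action as a linear map in `(X,Y,Z)`. -/
def actL {a b c : ℕ} (ψ : Fin a × Fin b × Fin c → ℂ) :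
    (Matrix (Fin a) (Fin a) ℂ × Matrix (Fin b) (Fin b) ℂ × Matrix (Fin c) (Fin c) ℂ)
      →ₗ[ℂ] (Fin a × Fin b × Fin c → ℂ) where
  toFun t := act t ψ
  map_add' t s := by
    funext p
    simp only [act, Prod.fst_add, Prod.snd_add, Matrix.add_apply, add_mul,
      Finset.sum_add_distrib, Pi.add_apply]
    ring
  map_smul' r t := by
    funext p
    simp only [act, Prod.smul_fst, Prod.smul_snd, Matrix.smul_apply, smul_eq_mul,
      Pi.smul_apply, RingHom.id_apply, Finset.mul_sum, mul_assoc, mul_add]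

/-- The tangent map `T_ψ : 𝔫₋(H) → ℋ₋(H,z)` is a linear isomorphism. -/
def TangentIso {a b c : ℕ} (HA : Fin a → ℝ) (HB : Fin b → ℝ) (HC : Fin c → ℝ)
    (z : ℝ) (ψ : Fin a × Fin b × Fin c → ℂ) : Prop :=
  ∃ h : ∀ t ∈ nMinusMod HA HB HC, actL ψ t ∈ weightNegSpace HA HB HC z,
    Function.Bijective ((actL ψ).restrict h)

/-- The tangent map `T_ψ : 𝔫₋(H) → ℋ₋(H,z)` is surjective. -/
def TangentSurj {a b c : ℕ} (HA : Fin a → ℝ) (HB : Fin b → ℝ) (HC : Fin c → ℝ)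
    (z : ℝ) (ψ : Fin a × Fin b × Fin c → ℂ) : Prop :=
  ∃ h : ∀ t ∈ nMinusMod HA HB HC, actL ψ t ∈ weightNegSpace HA HB HC z,
    Function.Surjective ((actL ψ).restrict h)

/-- `(H,z)` is admissible: the hyperplane `⟨(H,z), ·⟩ = 0` in `V` is spanned by
the weights of zero `(H,z)`-weight. -/
def Admissible {a b c : ℕ} (HA : Fin a → ℝ) (HB : Fin b → ℝ) (HC : Fin c → ℝ)
    (z : ℝ) : Prop :=
  (Submodule.span ℝ
    { w : (Fin a → ℝ) × (Fin b → ℝ) × (Fin c → ℝ) |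
      ∃ i j k, HA i + HB j + HC k + z = 0 ∧
        w = (Pi.single i 1, Pi.single j 1, Pi.single k 1) } : Set _)
  = { lam | (∑ i, lam.1 i) = (∑ j, lam.2.1 j) ∧ (∑ i, lam.1 i) = (∑ k, lam.2.2 k) ∧
        wtPair HA HB HC z lam = 0 }

/-- `(H,z)` is a Ressayre element. -/
def IsRessayre {a b c : ℕ} (HA : Fin a → ℝ) (HB : Fin b → ℝ) (HC : Fin c → ℝ)
    (z : ℝ) : Prop :=
  Traceless HA HB HC ∧ ¬(HA = 0 ∧ HB = 0 ∧ HC = 0 ∧ z = 0) ∧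
  Admissible HA HB HC z ∧
  ∃ ψ ∈ weight0Space HA HB HC z, TangentIso HA HB HC z ψ

/-- `(H_A, H_B)` satisfies the extremal-edge condition. -/
def ExtremalEdge {a b : ℕ} (HA : Fin a → ℝ) (HB : Fin b → ℝ) : Prop :=
  (∑ i, HA i) = 0 ∧ (∑ j, HB j) = 0 ∧ ¬(HA = 0 ∧ HB = 0) ∧
  ∀ (x : Fin a → ℝ) (y : Fin b → ℝ), (∑ i, x i) = 0 → (∑ j, y j) = 0 →
    (∀ i j k l, HA i + HB j = HA k + HB l → x i + y j = x k + y l) →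
    ∃ t : ℝ, x = t • HA ∧ y = t • HB

open scoped Kronecker in
/-- The matrix `X ⊗ I ⊗ I + I ⊗ Y ⊗ I + I ⊗ I ⊗ Z`. -/
def actMatrix {a b c : ℕ}
    (t : Matrix (Fin a) (Fin a) ℂ × Matrix (Fin b) (Fin b) ℂ × Matrix (Fin c) (Fin c) ℂ) :
    Matrix (Fin a × Fin b × Fin c) (Fin a × Fin b × Fin c) ℂ :=
  t.1 ⊗ₖ (1 : Matrix (Fin b × Fin c) (Fin b × Fin c) ℂ) +
    (1 : Matrix (Fin a) (Fin a) ℂ) ⊗ₖ (t.2.1 ⊗ₖ (1 : Matrix (Fin c) (Fin c) ℂ)) +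
    (1 : Matrix (Fin a) (Fin a) ℂ) ⊗ₖ ((1 : Matrix (Fin b) (Fin b) ℂ) ⊗ₖ t.2.2)

open scoped Kronecker Matrix in
theorem actMatrix_mulVec {a b c : ℕ}
    (t : Matrix (Fin a) (Fin a) ℂ × Matrix (Fin b) (Fin b) ℂ × Matrix (Fin c) (Fin c) ℂ)
    (ψ : Fin a × Fin b × Fin c → ℂ) : actMatrix t *ᵥ ψ = act t ψ := by
  funext ⟨i, j, k⟩
  simp only [actMatrix, act, Matrix.add_mulVec, Pi.add_apply]
  congr 1
  · congr 1
    · simp [Matrix.mulVec, dotProduct, Matrix.kroneckerMap_apply, Fintype.sum_prod_type,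
        Matrix.one_apply]
    · simp [Matrix.mulVec, dotProduct, Matrix.kroneckerMap_apply, Fintype.sum_prod_type,
        Matrix.one_apply]
  · simp [Matrix.mulVec, dotProduct, Matrix.kroneckerMap_apply, Fintype.sum_prod_type,
      Matrix.one_apply]

open scoped Kronecker Matrix in
theorem actMatrix_conjTranspose {a b c : ℕ}
    (X : Matrix (Fin a) (Fin a) ℂ) (Y : Matrix (Fin b) (Fin b) ℂ)
    (Z : Matrix (Fin c) (Fin c) ℂ) :
    (actMatrix (X, Y, Z))ᴴ = actMatrix (Xᴴ, Yᴴ, Zᴴ) := by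
  simp [actMatrix, Matrix.conjTranspose_kronecker]

open scoped Kronecker in
theorem sub_kronecker {m n : Type*} (A A' : Matrix m m ℂ) (B : Matrix n n ℂ) :
    (A - A') ⊗ₖ B = A ⊗ₖ B - A' ⊗ₖ B := by
  ext
  simp [sub_mul]

open scoped Kronecker in
theorem kronecker_sub {m n : Type*} (A : Matrix m m ℂ) (B B' : Matrix n n ℂ) :
    A ⊗ₖ (B - B') = A ⊗ₖ B - A ⊗ₖ B' := by
  ext
  simp [mul_sub]

open scoped Kronecker in
theorem actMatrix_commutator {a b c : ℕ}
    (X X' : Matrix (Fin a) (Fin a) ℂ) (Y Y' : Matrix (Fin b) (Fin b) ℂ)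
    (Z Z' : Matrix (Fin c) (Fin c) ℂ) :
    actMatrix (X, Y, Z) * actMatrix (X', Y', Z') - actMatrix (X', Y', Z') * actMatrix (X, Y, Z) =
      actMatrix (X * X' - X' * X, Y * Y' - Y' * Y, Z * Z' - Z' * Z) := by
  simp only [actMatrix, mul_add, add_mul, ← Matrix.mul_kronecker_mul, one_mul, mul_one,
    sub_kronecker, kronecker_sub]
  abel

open scoped Matrix in
/-- The expectation value of an infinitesimal local operator depends only on the reduced density
matrices. -/
theorem star_dotProduct_actMatrix_mulVec {a b c : ℕ}
    (t : Matrix (Fin a) (Fin a) ℂ × Matrix (Fin b) (Fin b) ℂ × Matrix (Fin c) (Fin c) ℂ)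
    (ψ : Fin a × Fin b × Fin c → ℂ) :
    star ψ ⬝ᵥ (actMatrix t *ᵥ ψ) =
      (t.1 * rhoA ψ).trace + (t.2.1 * rhoB ψ).trace + (t.2.2 * rhoC ψ).trace := by
  rw [actMatrix_mulVec]
  simp only [dotProduct, act, mul_add, Finset.sum_add_distrib, Fintype.sum_prod_type,
    Matrix.trace, Matrix.diag, Matrix.mul_apply, rhoA, rhoB, rhoC, Matrix.of_apply,
    Finset.mul_sum, Pi.star_apply, starRingEnd_apply]
  congr 1
  · congr 1
    · refine Finset.sum_congr rfl fun i _ => ?_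
      rw [Finset.sum_comm_cycle]
      refine Finset.sum_congr rfl fun i' _ => Finset.sum_congr rfl fun j _ =>
        Finset.sum_congr rfl fun k _ => by ring
    · rw [Finset.sum_comm]
      refine Finset.sum_congr rfl fun j _ => ?_
      rw [Finset.sum_comm_cycle]
      refine Finset.sum_congr rfl fun j' _ => Finset.sum_congr rfl fun i _ =>
        Finset.sum_congr rfl fun k _ => by ring
  · rw [Finset.sum_comm_cycle]
    refine Finset.sum_congr rfl fun k _ => ?_
    rw [Finset.sum_comm_cycle]
    refine Finset.sum_congr rfl fun k' _ => Finset.sum_congr rfl fun i _ =>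
      Finset.sum_congr rfl fun j _ => by ring

open scoped Matrix in
theorem trace_commutator_conjTranspose_mul_diagonal {n : ℕ} (X : Matrix (Fin n) (Fin n) ℂ)
    (d : Fin n → ℝ) :
    ((X * Xᴴ - Xᴴ * X) * Matrix.diagonal fun i => (d i : ℂ)).trace =
      ((∑ i, ∑ k, (d i - d k) * Complex.normSq (X i k) : ℝ) : ℂ) := by
  simp only [Matrix.trace, Matrix.diag, Matrix.mul_diagonal]
  simp only [Matrix.sub_apply, Matrix.mul_apply, Matrix.conjTranspose_apply, sub_mul, Finset.sum_mul, Finset.sum_sub_distrib,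
    Complex.ofReal_sub, Complex.ofReal_sum, Complex.ofReal_mul, ← Complex.mul_conj,
    starRingEnd_apply]
  congr 1
  · exact Finset.sum_congr rfl fun i _ => Finset.sum_congr rfl fun k _ => by ring
  · rw [Finset.sum_comm]
    exact Finset.sum_congr rfl fun i _ => Finset.sum_congr rfl fun k _ => by ring

theorem sub_mul_normSq_nonpos {n : ℕ} {X : Matrix (Fin n) (Fin n) ℂ} {d : Fin n → ℝ}
    (hd : StrictAnti d) (hX : ∀ i k, ¬ k < i → X i k = 0) (i k : Fin n) :
    (d i - d k) * Complex.normSq (X i k) ≤ 0 := by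
  by_cases h : k < i
  · exact mul_nonpos_of_nonpos_of_nonneg (sub_nonpos.2 (hd h).le) (Complex.normSq_nonneg _)
  · simp [hX i k h]

theorem sum_sub_mul_normSq_nonpos {n : ℕ} {X : Matrix (Fin n) (Fin n) ℂ} {d : Fin n → ℝ}
    (hd : StrictAnti d) (hX : ∀ i k, ¬ k < i → X i k = 0) :
    ∑ i, ∑ k, (d i - d k) * Complex.normSq (X i k) ≤ 0 :=
  Finset.sum_nonpos fun i _ => Finset.sum_nonpos fun k _ => sub_mul_normSq_nonpos hd hX i k

theorem eq_zero_of_sum_sub_mul_normSq_nonneg {n : ℕ} {X : Matrix (Fin n) (Fin n) ℂ}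
    {d : Fin n → ℝ} (hd : StrictAnti d) (hX : ∀ i k, ¬ k < i → X i k = 0)
    (h : 0 ≤ ∑ i, ∑ k, (d i - d k) * Complex.normSq (X i k)) : X = 0 := by
  have h₀ := (sum_sub_mul_normSq_nonpos hd hX).antisymm h
  rw [Finset.sum_eq_zero_iff_of_nonpos fun i _ =>
    Finset.sum_nonpos fun k _ => sub_mul_normSq_nonpos hd hX i k] at h₀
  ext i k
  by_cases hik : k < i
  · have h₁ := h₀ i (Finset.mem_univ i)
    rw [Finset.sum_eq_zero_iff_of_nonpos fun k _ => sub_mul_normSq_nonpos hd hX i k] at h₁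
    exact Complex.normSq_eq_zero.1
      ((mul_eq_zero.1 (h₁ k (Finset.mem_univ k))).resolve_left (sub_neg.2 (hd hik)).ne)
  · exact hX i k hik

open scoped Matrix ComplexOrder in
theorem eq_zero_of_act_eq_zero {a b c : ℕ} {ψ : Fin a × Fin b × Fin c → ℂ}
    {dA : Fin a → ℝ} {dB : Fin b → ℝ} {dC : Fin c → ℝ}
    (hdA : StrictAnti dA) (hdB : StrictAnti dB) (hdC : StrictAnti dC)
    (hA : rhoA ψ = Matrix.diagonal fun i => (dA i : ℂ))
    (hB : rhoB ψ = Matrix.diagonal fun j => (dB j : ℂ))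
    (hC : rhoC ψ = Matrix.diagonal fun k => (dC k : ℂ))
    {X : Matrix (Fin a) (Fin a) ℂ} {Y : Matrix (Fin b) (Fin b) ℂ} {Z : Matrix (Fin c) (Fin c) ℂ}
    (hX : ∀ i' i, ¬ i < i' → X i' i = 0) (hY : ∀ j' j, ¬ j < j' → Y j' j = 0)
    (hZ : ∀ k' k, ¬ k < k' → Z k' k = 0) (h : act (X, Y, Z) ψ = 0) :
    X = 0 ∧ Y = 0 ∧ Z = 0 := by
  have hpos : 0 ≤ star ψ ⬝ᵥ ((actMatrix (X, Y, Z) * (actMatrix (X, Y, Z))ᴴ -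
      (actMatrix (X, Y, Z))ᴴ * actMatrix (X, Y, Z)) *ᵥ ψ) := by
    rw [Matrix.sub_mulVec, ← Matrix.mulVec_mulVec ψ (actMatrix (X, Y, Z))ᴴ, actMatrix_mulVec, h,
      Matrix.mulVec_zero, sub_zero]
    exact (Matrix.posSemidef_self_mul_conjTranspose _).dotProduct_mulVec_nonneg ψ
  rw [actMatrix_conjTranspose, actMatrix_commutator, star_dotProduct_actMatrix_mulVec, hA, hB, hC]
    at hpos
  simp only [trace_commutator_conjTranspose_mul_diagonal] at hpos
  norm_cast at hpos
  have sX := sum_sub_mul_normSq_nonpos hdA hX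
  have sY := sum_sub_mul_normSq_nonpos hdB hY
  have sZ := sum_sub_mul_normSq_nonpos hdC hZ
  exact ⟨eq_zero_of_sum_sub_mul_normSq_nonneg hdA hX (by linarith),
    eq_zero_of_sum_sub_mul_normSq_nonneg hdB hY (by linarith),
    eq_zero_of_sum_sub_mul_normSq_nonneg hdC hZ (by linarith)⟩

/-- the infinitesimal action of triples of strictly lower-triangular
matrices is injective at a `ψ` with diagonal, strictly decreasing reduced density
matrices. -/
theorem act_injOn_strictly_lower_triangular (a b c : ℕ)
    (ha : 0 < a) (hb : 0 < b) (hc : 0 < c)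
    (ψ : Fin a × Fin b × Fin c → ℂ)
    (dA : Fin a → ℝ) (dB : Fin b → ℝ) (dC : Fin c → ℝ)
    (hdA : StrictAnti dA) (hdB : StrictAnti dB) (hdC : StrictAnti dC)
    (hA : rhoA ψ = Matrix.diagonal fun i => (dA i : ℂ))
    (hB : rhoB ψ = Matrix.diagonal fun j => (dB j : ℂ))
    (hC : rhoC ψ = Matrix.diagonal fun k => (dC k : ℂ)) :
    Set.InjOn (fun t => act t ψ)
      { t : Matrix (Fin a) (Fin a) ℂ × Matrix (Fin b) (Fin b) ℂ ×
          Matrix (Fin c) (Fin c) ℂ |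
        (∀ i' i, ¬ i < i' → t.1 i' i = 0) ∧
        (∀ j' j, ¬ j < j' → t.2.1 j' j = 0) ∧
        (∀ k' k, ¬ k < k' → t.2.2 k' k = 0) } := by
  rintro ⟨X, Y, Z⟩ ⟨hX, hY, hZ⟩ ⟨X', Y', Z'⟩ ⟨hX', hY', hZ'⟩ h
  have h₀ : act (X - X', Y - Y', Z - Z') ψ = 0 :=
    ((actL ψ).map_sub (X, Y, Z) (X', Y', Z')).trans (sub_eq_zero.2 h)
  obtain ⟨eX, eY, eZ⟩ := eq_zero_of_act_eq_zero hdA hdB hdC hA hB hC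
    (fun i k hik => by simpa using sub_eq_zero.2 ((hX i k hik).trans (hX' i k hik).symm))
    (fun i k hik => by simpa using sub_eq_zero.2 ((hY i k hik).trans (hY' i k hik).symm))
    (fun i k hik => by simpa using sub_eq_zero.2 ((hZ i k hik).trans (hZ' i k hik).symm)) h₀
  rw [sub_eq_zero.1 eX, sub_eq_zero.1 eY, sub_eq_zero.1 eZ]

end
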